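/- arXiv:0810.0325 — 4 statements merged into one kernel-verified Lean document; each statement's English description precedes it below -/
import Mathlib

section
/- Let X be a Banach space with a Schauder basis. Then there exists an infinite-dimensional block subspace W of X such that K(W) = K(V) for every infinite-dimensional block subspace V of W (such a set K(W) is called a stabilized Krivine set for X). -/
open scoped ENNReal
open Filter Topology

/-- The `ℓ_p` norm of a finite real sequence, `(∑ |a i|^p)^(1/p)` for `p < ∞`
and `max |a i|` for `p = ∞`. -/
noncomputable def lpNorm (p : ℝ≥0∞) {n : ℕ} (a : Fin n → ℝ) : ℝ :=
  if p = ∞ then ⨆ i, |a i| else (∑ i, |a i| ^ p.toReal) ^ (1 / p.toReal)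

/-- `e` is a Schauder basis of `X`: every vector has a unique representation as a
norm-convergent series `∑ a i • e i`. -/
def IsSchauderBasis {X : Type*} [NormedAddCommGroup X] [NormedSpace ℝ X] (e : ℕ → X) : Prop :=
  ∀ x : X, ∃! a : ℕ → ℝ,
    Tendsto (fun n => ∑ i ∈ Finset.range n, a i • e i) atTop (𝓝 x)

/-- `y` is an (infinite) block basic sequence of `e`: a sequence of nonzero vectors with
finite, successively ordered supports with respect to `e`. -/
def IsBlockSeq {X : Type*} [NormedAddCommGroup X] [NormedSpace ℝ X] (e : ℕ → X) (y : ℕ → X) : Prop :=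
  ∃ N : ℕ → ℕ, StrictMono N ∧ ∀ k, y k ≠ 0 ∧
    y k ∈ Submodule.span ℝ (e '' Set.Ico (N k) (N (k + 1)))

/-- A block subspace: the closed linear span of an infinite block basic sequence of `e`. -/
def IsBlockSubspace {X : Type*} [NormedAddCommGroup X] [NormedSpace ℝ X] (e : ℕ → X)
    (Y : Submodule ℝ X) : Prop :=
  ∃ y : ℕ → X, IsBlockSeq e y ∧ Y = (Submodule.span ℝ (Set.range y)).topologicalClosure

/-- `y` is a finite block basic sequence of `e` (length `n`): nonzero vectors with
finite, successively ordered supports with respect to `e`. -/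
def IsFinBlockSeq {X : Type*} [NormedAddCommGroup X] [NormedSpace ℝ X] (e : ℕ → X) {n : ℕ}
    (y : Fin n → X) : Prop :=
  ∃ N : ℕ → ℕ, StrictMono N ∧ ∀ k : Fin n, y k ≠ 0 ∧
    y k ∈ Submodule.span ℝ (e '' Set.Ico (N k.val) (N (k.val + 1)))

/-- `(y i)_{i<n}` is `C`-equivalent to the unit vector basis of `ℓ_p^n`
(of `c_0^n`, i.e. `ℓ_∞^n`, when `p = ∞`). -/
def FinLpEquiv {X : Type*} [NormedAddCommGroup X] [NormedSpace ℝ X] (C : ℝ) (p : ℝ≥0∞) {n : ℕ}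
    (y : Fin n → X) : Prop :=
  ∀ a : Fin n → ℝ,
    C⁻¹ * lpNorm p a ≤ ‖∑ i, a i • y i‖ ∧ ‖∑ i, a i • y i‖ ≤ C * lpNorm p a

/-- The Krivine set `K(W)`: the set of `p ∈ [1, ∞]` such that `ℓ_p` (or `c_0` when `p = ∞`)
is finitely block represented in `W`, i.e. for every `n` and `ε > 0` there is a normalized
block basic sequence of length `n` with entries in `W` that is `(1+ε)`-equivalent to the
unit vector basis of `ℓ_p^n`. -/
def KrivineSet {X : Type*} [NormedAddCommGroup X] [NormedSpace ℝ X] (e : ℕ → X)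
    (W : Submodule ℝ X) : Set ℝ≥0∞ :=
  {p | 1 ≤ p ∧ ∀ (n : ℕ) (ε : ℝ), 0 < ε → ∃ y : Fin n → X,
    IsFinBlockSeq e y ∧ (∀ i, ‖y i‖ = 1 ∧ y i ∈ W) ∧ FinLpEquiv (1 + ε) p y}

lemma ContinuousMap.tendsto_onePoint_nat {Y : Type*} [TopologicalSpace Y] (f : C(OnePoint ℕ, Y)) :
    Tendsto (fun n : ℕ => f (n : OnePoint ℕ)) atTop (𝓝 (f OnePoint.infty)) :=
  (OnePoint.continuous_iff_from_nat f).1 f.continuous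

section SchauderProjections

variable {X : Type*} [NormedAddCommGroup X] [NormedSpace ℝ X]

/-- The convergent sequences of partial sums of series `∑ a i • e i`, as continuous functions on
the one-point compactification of `ℕ`. -/
def partialSumSpace (e : ℕ → X) : Submodule ℝ C(OnePoint ℕ, X) where
  carrier := {f | f ((0 : ℕ) : OnePoint ℕ) = 0 ∧
    ∀ n : ℕ, f ((n + 1 : ℕ) : OnePoint ℕ) - f (n : OnePoint ℕ) ∈ Submodule.span ℝ {e n}}
  add_mem' := by
    rintro f g ⟨hf, hf'⟩ ⟨hg, hg'⟩
    refine ⟨by simp [hf, hg], fun n => ?_⟩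
    have := add_mem (hf' n) (hg' n)
    simpa [add_sub_add_comm] using this
  zero_mem' := by simp
  smul_mem' := by
    rintro c f ⟨hf, hf'⟩
    refine ⟨by simp [hf], fun n => ?_⟩
    have := Submodule.smul_mem _ c (hf' n)
    simpa [smul_sub] using this

lemma isClosed_partialSumSpace (e : ℕ → X) :
    IsClosed (partialSumSpace e : Set C(OnePoint ℕ, X)) := by
  have h : (partialSumSpace e : Set C(OnePoint ℕ, X)) =
      {f | f ((0 : ℕ) : OnePoint ℕ) = 0} ∩ ⋂ n : ℕ,
        {f | f ((n + 1 : ℕ) : OnePoint ℕ) - f (n : OnePoint ℕ) ∈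
          (Submodule.span ℝ {e n} : Set X)} := by
    ext f
    simp [partialSumSpace]
  rw [h]
  refine IsClosed.inter (isClosed_eq (by fun_prop) continuous_const)
    (isClosed_iInter fun n => ?_)
  exact (Submodule.closed_of_finiteDimensional (Submodule.span ℝ {e n})).preimage (by fun_prop)

lemma exists_coeff_of_mem_partialSumSpace {e : ℕ → X} {f : C(OnePoint ℕ, X)}
    (hf : f ∈ partialSumSpace e) :
    ∃ a : ℕ → ℝ, ∀ n : ℕ, f (n : OnePoint ℕ) = ∑ i ∈ Finset.range n, a i • e i := by
  choose a ha using fun n => Submodule.mem_span_singleton.1 (hf.2 n)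
  refine ⟨a, fun n => ?_⟩
  induction n with
  | zero => simpa using hf.1
  | succ n ih => rw [Finset.sum_range_succ, ← ih, ha, add_sub_cancel]

/-- The element of `partialSumSpace e` given by a convergent series. -/
lemma exists_mem_partialSumSpace {e : ℕ → X} {a : ℕ → ℝ} {x : X}
    (h : Tendsto (fun n => ∑ i ∈ Finset.range n, a i • e i) atTop (𝓝 x)) :
    ∃ f ∈ partialSumSpace e, f OnePoint.infty = x ∧
      ∀ n : ℕ, f (n : OnePoint ℕ) = ∑ i ∈ Finset.range n, a i • e i := by
  refine ⟨OnePoint.continuousMapMkNat _ x h, ⟨?_, fun n => ?_⟩, rfl, fun n => rfl⟩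
  · change ∑ i ∈ Finset.range 0, a i • e i = 0
    simp
  · change ∑ i ∈ Finset.range (n + 1), a i • e i - ∑ i ∈ Finset.range n, a i • e i ∈ _
    rw [Finset.sum_range_succ, add_sub_cancel_left]
    exact Submodule.smul_mem _ _ (Submodule.mem_span_singleton_self _)

/-- The partial sum projections of a Schauder basis of a Banach space are continuous. -/
theorem IsSchauderBasis.exists_proj [CompleteSpace X] {e : ℕ → X} (he : IsSchauderBasis e)
    (m : ℕ) : ∃ S : X →L[ℝ] X, ∀ i, S (e i) = if i < m then e i else 0 := by
  have : CompleteSpace (partialSumSpace e) := (isClosed_partialSumSpace e).completeSpace_coe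
  let ev : partialSumSpace e →L[ℝ] X :=
    (ContinuousMap.evalCLM ℝ (OnePoint.infty : OnePoint ℕ)).comp (partialSumSpace e).subtypeL
  have hev : ∀ f, ev f = f.1 OnePoint.infty := fun f => rfl
  have hinj : Function.Injective ev := by
    refine (injective_iff_map_eq_zero ev).2 fun f hf => ?_
    obtain ⟨a, ha⟩ := exists_coeff_of_mem_partialSumSpace f.2
    have ht := f.1.tendsto_onePoint_nat
    rw [← hev, hf] at ht
    simp only [ha] at ht
    have ha0 : a = 0 := (he 0).unique ht (by simp)
    refine Subtype.ext (ContinuousMap.ext fun x => ?_)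
    induction x using OnePoint.rec with
    | infty => exact hf
    | coe n => rw [ha, ha0]; simp
  have hsurj : Function.Surjective ev := by
    intro x
    obtain ⟨a, ha, -⟩ := he x
    obtain ⟨f, hf, hfx, -⟩ := exists_mem_partialSumSpace ha
    exact ⟨⟨f, hf⟩, hfx⟩
  let T := ContinuousLinearEquiv.ofBijective ev (LinearMap.ker_eq_bot.2 hinj)
    (LinearMap.range_eq_top.2 hsurj)
  refine ⟨((ContinuousMap.evalCLM ℝ (m : OnePoint ℕ)).comp
    (partialSumSpace e).subtypeL).comp T.symm.toContinuousLinearMap, fun i => ?_⟩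
  have hsum : ∀ n, ∑ j ∈ Finset.range n, (Pi.single i 1 : ℕ → ℝ) j • e j =
      if i < n then e i else 0 := by
    intro n
    simp [Pi.single_apply, ite_smul]
  have ht : Tendsto (fun n => ∑ j ∈ Finset.range n, (Pi.single i 1 : ℕ → ℝ) j • e j) atTop
      (𝓝 (e i)) := by
    refine tendsto_const_nhds.congr' ?_
    filter_upwards [eventually_gt_atTop i] with n hn
    rw [hsum, if_pos hn]
  obtain ⟨f, hf, hfx, hfn⟩ := exists_mem_partialSumSpace ht
  have hT : T.symm (e i) = ⟨f, hf⟩ := by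
    rw [ContinuousLinearEquiv.symm_apply_eq]
    exact hfx.symm
  change (T.symm (e i)).1 (m : OnePoint ℕ) = _
  rw [hT, ← hsum]
  exact hfn m

lemma IsSchauderBasis.ne_zero {e : ℕ → X} (he : IsSchauderBasis e) (i : ℕ) : e i ≠ 0 := by
  intro h
  have h1 : (Pi.single i 1 : ℕ → ℝ) = 0 := by
    refine (he 0).unique ?_ (by simp)
    refine tendsto_const_nhds.congr fun n => ?_
    rw [Finset.sum_eq_zero]
    intro j _
    by_cases hj : j = i
    · simp [hj, h]
    · simp [hj]
  simpa using congrFun h1 i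

end SchauderProjections

section LpNorm

lemma lpNorm_top {n : ℕ} (a : Fin n → ℝ) : lpNorm ∞ a = ⨆ i, |a i| := if_pos rfl

lemma lpNorm_of_ne_top {p : ℝ≥0∞} (hp : p ≠ ∞) {n : ℕ} (a : Fin n → ℝ) :
    lpNorm p a = (∑ i, |a i| ^ p.toReal) ^ (1 / p.toReal) := if_neg hp

lemma lpNorm_nonneg (p : ℝ≥0∞) {n : ℕ} (a : Fin n → ℝ) : 0 ≤ lpNorm p a := by
  unfold lpNorm
  split_ifs
  · exact Real.iSup_nonneg fun i => abs_nonneg _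
  · positivity

lemma lpNorm_append_zero {p : ℝ≥0∞} (hp : 1 ≤ p) (m : ℕ) {n : ℕ} (a : Fin n → ℝ) :
    lpNorm p (Fin.append (0 : Fin m → ℝ) a) = lpNorm p a := by
  by_cases hpt : p = ∞
  · subst hpt
    rw [lpNorm_top, lpNorm_top]
    have h0 : 0 ≤ ⨆ i, |a i| := Real.iSup_nonneg fun i => abs_nonneg _
    apply le_antisymm
    · refine Real.iSup_le (fun i => ?_) h0
      induction i using Fin.addCases with
      | left i => simpa using h0
      | right i =>
        rw [Fin.append_right]
        exact le_ciSup (f := fun i => |a i|) (Set.finite_range _).bddAbove i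
    · refine Real.iSup_le (fun i => ?_) (Real.iSup_nonneg fun i => abs_nonneg _)
      have := le_ciSup (f := fun i => |Fin.append (0 : Fin m → ℝ) a i|)
        (Set.finite_range _).bddAbove (Fin.natAdd m i)
      simpa using this
  · have hp0 : p.toReal ≠ 0 := (ENNReal.toReal_pos (by positivity) hpt).ne'
    rw [lpNorm_of_ne_top hpt, lpNorm_of_ne_top hpt, Fin.sum_univ_add]
    simp [Real.zero_rpow hp0]

/-- Comparison of `ℓ_p` and `ℓ_q` norms: `‖a‖_q ≤ ‖a‖_p ≤ n ^ (1/p - 1/q) ‖a‖_q` for `p ≤ q`. -/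
lemma lp_norm_comparison {n : ℕ} (a : Fin n → ℝ) {p q : ℝ} (hp : 1 ≤ p) (hpq : p ≤ q) :
    (∑ i, |a i| ^ q) ^ (1 / q) ≤ (∑ i, |a i| ^ p) ^ (1 / p) ∧
    (∑ i, |a i| ^ p) ^ (1 / p) ≤ (n : ℝ) ^ (1 / p - 1 / q) * (∑ i, |a i| ^ q) ^ (1 / q) := by
  have hp0 : 0 < p := by linarith
  have hq0 : 0 < q := by linarith
  have hqp : 1 ≤ q / p := (one_le_div hp0).2 hpq
  set S := ∑ i, |a i| ^ p with hS
  have hSnn : 0 ≤ S := by positivity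
  have hpow : ∀ i, |a i| ^ q = (|a i| ^ p) ^ (q / p) := fun i => by
    rw [← Real.rpow_mul (abs_nonneg _), mul_div_cancel₀ _ hp0.ne']
  have hSq : (S ^ (q / p)) ^ (1 / q) = S ^ (1 / p) := by
    rw [← Real.rpow_mul hSnn]
    congr 1
    field_simp
  constructor
  · rw [← hSq]
    refine Real.rpow_le_rpow (by positivity) ?_ (by positivity)
    have hsplit : ∀ x : ℝ, 0 ≤ x → x ^ (q / p) = x * x ^ (q / p - 1) := fun x hx => by
      rw [← Real.rpow_one_add' hx (by linarith)]
      congr 1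
      ring
    rw [hsplit S hSnn]
    conv_rhs => rw [hS, Finset.sum_mul]
    refine Finset.sum_le_sum fun i _ => ?_
    rw [hpow, hsplit _ (by positivity)]
    refine mul_le_mul_of_nonneg_left ?_ (by positivity)
    refine Real.rpow_le_rpow (by positivity) ?_ (by linarith)
    exact Finset.single_le_sum (f := fun i => |a i| ^ p) (fun i _ => by positivity)
      (Finset.mem_univ i)
  · have h := Real.rpow_sum_le_const_mul_sum_rpow_of_nonneg (s := Finset.univ)
      (f := fun i => |a i| ^ p) hqp (fun i _ => by positivity)
    have h' := Real.rpow_le_rpow (z := 1 / q) (by positivity) h (by positivity)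
    rw [Finset.card_univ, Fintype.card_fin, Real.mul_rpow (by positivity) (by positivity),
      ← Real.rpow_mul (Nat.cast_nonneg n)] at h'
    simp only [← hpow] at h'
    rw [← hS, hSq] at h'
    convert h' using 3
    field_simp

lemma lpNorm_le_rpow_mul {n : ℕ} (a : Fin n → ℝ) {p q : ℝ≥0∞} (hp : 1 ≤ p) (hq : 1 ≤ q)
    (hpt : p ≠ ∞) (hqt : q ≠ ∞) :
    lpNorm p a ≤ ((n : ℝ) + 1) ^ |1 / p.toReal - 1 / q.toReal| * lpNorm q a := by
  have hp1 : 1 ≤ p.toReal := by simpa using ENNReal.toReal_mono hpt hp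
  have hq1 : 1 ≤ q.toReal := by simpa using ENNReal.toReal_mono hqt hq
  have hnn := lpNorm_nonneg q a
  rw [lpNorm_of_ne_top hqt] at hnn
  rw [lpNorm_of_ne_top hpt, lpNorm_of_ne_top hqt]
  rcases le_total p.toReal q.toReal with h | h
  · refine (lp_norm_comparison a hp1 h).2.trans (mul_le_mul_of_nonneg_right ?_ hnn)
    have hd : 0 ≤ 1 / p.toReal - 1 / q.toReal :=
      sub_nonneg.2 (one_div_le_one_div_of_le (by linarith) h)
    rw [abs_of_nonneg hd]
    exact Real.rpow_le_rpow (by positivity) (by linarith) hd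
  · refine (lp_norm_comparison a hq1 h).1.trans (le_mul_of_one_le_left hnn ?_)
    exact Real.one_le_rpow (by linarith [(Nat.cast_nonneg n : (0 : ℝ) ≤ n)]) (abs_nonneg _)

/-- A countable family of sets of exponents, fine enough that near any exponent the `ℓ_p^n` norms
are uniformly close to each other. -/
lemma exists_exponent_cells : ∃ U : ℕ → Set ℝ≥0∞, ∀ p : ℝ≥0∞, 1 ≤ p → ∀ (n : ℕ) (ε : ℝ), 0 < ε →
    ∃ j, p ∈ U j ∧ ∀ q ∈ U j, 1 ≤ q → ∀ a : Fin n → ℝ,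
      lpNorm q a ≤ (1 + ε) * lpNorm p a ∧ lpNorm p a ≤ (1 + ε) * lpNorm q a := by
  obtain ⟨U, hU⟩ := ((TopologicalSpace.countable_countableBasis ℝ≥0∞).insert
    ({∞} : Set ℝ≥0∞)).exists_eq_range (Set.insert_nonempty _ _)
  refine ⟨U, fun p hp n ε hε => ?_⟩
  by_cases hpt : p = ∞
  · obtain ⟨j, hj⟩ : ({∞} : Set ℝ≥0∞) ∈ Set.range U := hU ▸ Set.mem_insert _ _
    refine ⟨j, by simp [hj, hpt], fun q hq _ a => ?_⟩
    rw [hj, Set.mem_singleton_iff] at hq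
    rw [hq, hpt]
    have := lpNorm_nonneg ∞ a
    constructor <;> nlinarith
  · have hp0 : p.toReal ≠ 0 := (ENNReal.toReal_pos (by positivity) hpt).ne'
    have hcont : ContinuousAt
        (fun q : ℝ≥0∞ => ((n : ℝ) + 1) ^ |1 / p.toReal - 1 / q.toReal|) p := by
      have h1 : ContinuousAt (fun q : ℝ≥0∞ => q.toReal) p := ENNReal.tendsto_toReal hpt
      have h2 : ContinuousAt (fun q : ℝ≥0∞ => |1 / p.toReal - 1 / q.toReal|) p :=
        (continuousAt_const.sub (continuousAt_const.div h1 hp0)).abs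
      exact continuousAt_const.rpow h2 (Or.inl (by positivity))
    have hev : ∀ᶠ q in 𝓝 p,
        ((n : ℝ) + 1) ^ |1 / p.toReal - 1 / q.toReal| < 1 + ε ∧ q ≠ ∞ :=
      (hcont.eventually (gt_mem_nhds (by simpa using hε))).and
        (eventually_ne_nhds hpt)
    obtain ⟨V, hVB, hpV, hV⟩ :=
      (TopologicalSpace.isBasis_countableBasis ℝ≥0∞).mem_nhds_iff.1 hev
    obtain ⟨j, rfl⟩ : V ∈ Set.range U := hU ▸ Set.mem_insert_of_mem _ hVB
    refine ⟨j, hpV, fun q hq hq1 a => ?_⟩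
    obtain ⟨hlt, hqt⟩ := hV hq
    have h1 := lpNorm_le_rpow_mul a hp hq1 hpt hqt
    have h2 := lpNorm_le_rpow_mul a hq1 hp hqt hpt
    rw [abs_sub_comm] at h2
    exact ⟨h2.trans (mul_le_mul_of_nonneg_right hlt.le (lpNorm_nonneg _ _)),
      h1.trans (mul_le_mul_of_nonneg_right hlt.le (lpNorm_nonneg _ _))⟩

end LpNorm

section BlockSubspaces

variable {X : Type*} [NormedAddCommGroup X] [NormedSpace ℝ X]

/-- The closed linear span of a sequence. -/
abbrev closedSpan (y : ℕ → X) : Submodule ℝ X :=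
  (Submodule.span ℝ (Set.range y)).topologicalClosure

lemma mem_closedSpan (y : ℕ → X) (k : ℕ) : y k ∈ closedSpan y :=
  Submodule.le_topologicalClosure _ (Submodule.subset_span ⟨k, rfl⟩)

lemma closedSpan_le {y : ℕ → X} {Y : Submodule ℝ X} (hY : IsClosed (Y : Set X))
    (h : ∀ k, y k ∈ Y) : closedSpan y ≤ Y :=
  Submodule.topologicalClosure_minimal _
    (Submodule.span_le.2 (Set.range_subset_iff.2 h)) hY

lemma isClosed_closedSpan (y : ℕ → X) : IsClosed (closedSpan y : Set X) :=
  Submodule.isClosed_topologicalClosure _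

/-- A vector of the closed span of the blocks `w k` whose support starts at or after that of
`w k₀` lies in the closed span of the blocks from `k₀` on. -/
lemma IsSchauderBasis.mem_of_mem_closedSpan [CompleteSpace X] {e : ℕ → X}
    (he : IsSchauderBasis e) {w : ℕ → X} {N : ℕ → ℕ} (hN : StrictMono N)
    (hw : ∀ k, w k ∈ Submodule.span ℝ (e '' Set.Ico (N k) (N (k + 1)))) {Y : Submodule ℝ X}
    (hY : IsClosed (Y : Set X)) {k₀ : ℕ} (hwY : ∀ k, k₀ ≤ k → w k ∈ Y) {x : X}
    (hx : x ∈ closedSpan w) (hxs : x ∈ Submodule.span ℝ (e '' Set.Ici (N k₀))) : x ∈ Y := by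
  obtain ⟨S, hS⟩ := he.exists_proj (N k₀)
  have hS0 : ∀ z ∈ Submodule.span ℝ (e '' Set.Ici (N k₀)), S z = 0 := by
    intro z hz
    have : Submodule.span ℝ (e '' Set.Ici (N k₀)) ≤ LinearMap.ker S.toLinearMap := by
      rw [Submodule.span_le]
      rintro _ ⟨i, hi, rfl⟩
      have hi' : ¬ i < N k₀ := not_lt.2 hi
      simp [hS, hi']
    exact this hz
  have hS1 : ∀ z ∈ Submodule.span ℝ (e '' Set.Iio (N k₀)), S z = z := by
    intro z hz
    have : Submodule.span ℝ (e '' Set.Iio (N k₀)) ≤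
        LinearMap.eqLocus S.toLinearMap LinearMap.id := by
      rw [Submodule.span_le]
      rintro _ ⟨i, hi, rfl⟩
      have hi' : i < N k₀ := hi
      simp [hS, hi']
    exact this hz
  let T : X →L[ℝ] X := ContinuousLinearMap.id ℝ X - S
  have hle : closedSpan w ≤ Y.comap T.toLinearMap := by
    refine closedSpan_le (hY.preimage T.continuous) fun k => ?_
    change w k - S (w k) ∈ Y
    rcases lt_or_ge k k₀ with hk | hk
    · rw [hS1 _ (Submodule.span_mono (Set.image_mono fun i hi =>
        lt_of_lt_of_le hi.2 (hN.monotone hk)) (hw k)), sub_self]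
      exact Y.zero_mem
    · rw [hS0 _ (Submodule.span_mono (Set.image_mono fun i hi =>
        (hN.monotone hk).trans hi.1) (hw k)), sub_zero]
      exact hwY k hk
  have hTx : x - S x ∈ Y := hle hx
  rwa [hS0 x hxs, sub_zero] at hTx

lemma krivineSet_mono (e : ℕ → X) {V W : Submodule ℝ X} (h : V ≤ W) :
    KrivineSet e V ⊆ KrivineSet e W := fun p ⟨hp, H⟩ => ⟨hp, fun n ε hε => by
  obtain ⟨y, hy, hyV, hyp⟩ := H n ε hε
  exact ⟨y, hy, fun i => ⟨(hyV i).1, h (hyV i).2⟩, hyp⟩⟩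

/-- The finite block sequences witnessing that `p` is in the Krivine set can be chosen with
supports arbitrarily far out. -/
lemma exists_far_finBlockSeq {e : ℕ → X} {V : Submodule ℝ X} {p : ℝ≥0∞} (hp : p ∈ KrivineSet e V)
    (m n : ℕ) {ε : ℝ} (hε : 0 < ε) : ∃ y : Fin n → X, IsFinBlockSeq e y ∧
      (∀ i, ‖y i‖ = 1 ∧ y i ∈ V) ∧ FinLpEquiv (1 + ε) p y ∧
      ∀ i, y i ∈ Submodule.span ℝ (e '' Set.Ici m) := by
  obtain ⟨hp1, H⟩ := hp
  obtain ⟨y, ⟨N, hN, hyN⟩, hyV, hyp⟩ := H (m + n) ε hε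
  refine ⟨fun i => y (Fin.natAdd m i), ⟨fun k => N (m + k), fun a b hab => hN (by omega),
    fun k => ?_⟩, fun i => hyV _, fun a => ?_, fun i => ?_⟩
  · simpa [add_assoc] using hyN (Fin.natAdd m k)
  · have := hyp (Fin.append 0 a)
    rw [lpNorm_append_zero hp1, Fin.sum_univ_add] at this
    simpa using this
  · refine Submodule.span_mono (Set.image_mono fun j hj => ?_) (hyN (Fin.natAdd m i)).2
    have h1 : N (m + i) ≤ j := hj.1
    have h2 : m + i ≤ N (m + i) := hN.le_apply
    exact Set.mem_Ici.2 (by omega)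

/-- If all but finitely many blocks lie in the closed subspace `Y`, the Krivine set of the block
subspace is contained in that of `Y`. -/
lemma IsSchauderBasis.krivineSet_subset [CompleteSpace X] {e : ℕ → X} (he : IsSchauderBasis e)
    {v : ℕ → X} (hv : IsBlockSeq e v) {Y : Submodule ℝ X} (hY : IsClosed (Y : Set X)) {m : ℕ}
    (hvY : ∀ k, m ≤ k → v k ∈ Y) : KrivineSet e (closedSpan v) ⊆ KrivineSet e Y := by
  obtain ⟨N, hN, hvN⟩ := hv
  refine fun p hp => ⟨hp.1, fun n ε hε => ?_⟩
  obtain ⟨y, hy, hyV, hyp, hyf⟩ := exists_far_finBlockSeq hp (N m) n hε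
  exact ⟨y, hy, fun i => ⟨(hyV i).1,
    he.mem_of_mem_closedSpan hN (fun k => (hvN k).2) hY hvY (hyV i).2 (hyf i)⟩, hyp⟩

/-- Exponents outside a Krivine set are separated from it by a cell. -/
lemma exists_cell_disjoint_krivineSet {U : ℕ → Set ℝ≥0∞}
    (hU : ∀ p : ℝ≥0∞, 1 ≤ p → ∀ (n : ℕ) (ε : ℝ), 0 < ε →
      ∃ j, p ∈ U j ∧ ∀ q ∈ U j, 1 ≤ q → ∀ a : Fin n → ℝ,
        lpNorm q a ≤ (1 + ε) * lpNorm p a ∧ lpNorm p a ≤ (1 + ε) * lpNorm q a)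
    (e : ℕ → X) (V : Submodule ℝ X) {p : ℝ≥0∞} (hp : 1 ≤ p) (hpV : p ∉ KrivineSet e V) :
    ∃ j, p ∈ U j ∧ Disjoint (U j) (KrivineSet e V) := by
  have : ∃ (n : ℕ) (ε : ℝ), 0 < ε ∧ ∀ y : Fin n → X, IsFinBlockSeq e y →
      (∀ i, ‖y i‖ = 1 ∧ y i ∈ V) → ¬ FinLpEquiv (1 + ε) p y := by
    by_contra! h
    exact hpV ⟨hp, h⟩
  obtain ⟨n, ε, hε, hn⟩ := this
  obtain ⟨δ, hδ, hδε⟩ : ∃ δ : ℝ, 0 < δ ∧ (1 + δ) * (1 + δ) ≤ 1 + ε := by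
    refine ⟨min 1 (ε / 3), by positivity, ?_⟩
    have h1 := min_le_left 1 (ε / 3)
    have h2 := min_le_right 1 (ε / 3)
    have h3 : 0 < min 1 (ε / 3) := by positivity
    nlinarith
  obtain ⟨j, hpj, hj⟩ := hU p hp n δ hδ
  refine ⟨j, hpj, Set.disjoint_left.2 fun q hqj hq => ?_⟩
  obtain ⟨y, hy, hyV, hyq⟩ := hq.2 n δ hδ
  refine hn y hy hyV fun a => ?_
  obtain ⟨hlow, hup⟩ := hyq a
  obtain ⟨h1, h2⟩ := hj q hqj hq.1 a
  have hpnn := lpNorm_nonneg p a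
  constructor
  · refine le_trans ?_ hlow
    rw [inv_mul_le_iff₀ (by positivity)]
    calc lpNorm p a ≤ (1 + δ) * lpNorm q a := h2
      _ = ((1 + δ) * (1 + δ)) * ((1 + δ)⁻¹ * lpNorm q a) := by field_simp
      _ ≤ (1 + ε) * ((1 + δ)⁻¹ * lpNorm q a) := by
        have := lpNorm_nonneg q a
        gcongr
  · calc _ ≤ (1 + δ) * lpNorm q a := hup
      _ ≤ (1 + δ) * ((1 + δ) * lpNorm p a) := by gcongr
      _ = ((1 + δ) * (1 + δ)) * lpNorm p a := by ring
      _ ≤ _ := by gcongr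

lemma IsBlockSeq.shift {e v : ℕ → X} (hv : IsBlockSeq e v) (m : ℕ) :
    IsBlockSeq e fun k => v (k + m) := by
  obtain ⟨N, hN, hvN⟩ := hv
  refine ⟨fun k => N (k + m), fun a b hab => hN (by omega), fun k => ?_⟩
  have := hvN (k + m)
  rwa [add_right_comm] at this

/-- A diagonal block sequence through a sequence of block sequences. -/
lemma exists_diagonal_blockSeq {e : ℕ → X} {y : ℕ → ℕ → X} (hy : ∀ j, IsBlockSeq e (y j)) :
    ∃ w, IsBlockSeq e w ∧ ∀ k, w k ∈ closedSpan (y k) := by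
  have hstep : ∀ j M : ℕ, ∃ (M' : ℕ) (x : X), M < M' ∧ x ≠ 0 ∧ x ∈ closedSpan (y j) ∧
      x ∈ Submodule.span ℝ (e '' Set.Ico M M') := by
    intro j M
    obtain ⟨N, hN, hyN⟩ := hy j
    have hM : M ≤ N M := hN.le_apply
    refine ⟨N (M + 1), y j M, hM.trans_lt (hN (Nat.lt_succ_self M)), (hyN M).1,
      mem_closedSpan _ _, ?_⟩
    exact Submodule.span_mono (Set.image_mono (Set.Ico_subset_Ico_left hM)) (hyN M).2
  choose f g hlt hne hmem hspan using hstep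
  let N : ℕ → ℕ := fun k => Nat.rec 0 (fun k M => f k M) k
  exact ⟨fun k => g k (N k), ⟨N, strictMono_nat_of_lt_succ fun k => hlt k (N k),
    fun k => ⟨hne _ _, hspan k (N k)⟩⟩, fun k => hmem _ _⟩

lemma IsSchauderBasis.isBlockSeq {e : ℕ → X} (he : IsSchauderBasis e) : IsBlockSeq e e :=
  ⟨id, strictMono_id, fun k => ⟨he.ne_zero k, Submodule.subset_span ⟨k, by simp, rfl⟩⟩⟩

/-- Greedy construction of a decreasing sequence of block subspaces deciding, for each `j`,
whether the set `U j` can be made to miss the Krivine set. -/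
lemma exists_deciding_blockSeqs {e : ℕ → X} (he : IsSchauderBasis e) (U : ℕ → Set ℝ≥0∞) :
    ∃ y : ℕ → ℕ → X, (∀ j, IsBlockSeq e (y j)) ∧
      Antitone (fun j => closedSpan (y j)) ∧
      ∀ j v, IsBlockSeq e v → closedSpan v ≤ closedSpan (y j) →
        Disjoint (U j) (KrivineSet e (closedSpan v)) →
        Disjoint (U j) (KrivineSet e (closedSpan (y (j + 1)))) := by
  have hstep : ∀ (j : ℕ) (y : {y : ℕ → X // IsBlockSeq e y}), ∃ z : {y : ℕ → X // IsBlockSeq e y},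
      closedSpan z.1 ≤ closedSpan y.1 ∧ ∀ v, IsBlockSeq e v → closedSpan v ≤ closedSpan y.1 →
        Disjoint (U j) (KrivineSet e (closedSpan v)) →
        Disjoint (U j) (KrivineSet e (closedSpan z.1)) := by
    intro j y
    by_cases h : ∃ v, IsBlockSeq e v ∧ closedSpan v ≤ closedSpan y.1 ∧
        Disjoint (U j) (KrivineSet e (closedSpan v))
    · obtain ⟨v, hv, hvy, hd⟩ := h
      exact ⟨⟨v, hv⟩, hvy, fun _ _ _ _ => hd⟩
    · exact ⟨y, le_rfl, fun v hv hvy hd => absurd ⟨v, hv, hvy, hd⟩ h⟩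
  choose F hF hF' using hstep
  let y : ℕ → {y : ℕ → X // IsBlockSeq e y} := fun j => Nat.rec ⟨e, he.isBlockSeq⟩ F j
  exact ⟨fun j => (y j).1, fun j => (y j).2, antitone_nat_of_succ_le fun j => hF j (y j),
    fun j => hF' j (y j)⟩

end BlockSubspaces

/-- There is an infinite-dimensional block subspace `W` of `X` such that `K(V) = K(W)` for
every infinite-dimensional block subspace `V` of `W`; `K(W)` is then a stabilized Krivine
set for `X`. -/
theorem exists_stabilized_krivine_set {X : Type*} [NormedAddCommGroup X] [NormedSpace ℝ X]
    [CompleteSpace X] (e : ℕ → X) (he : IsSchauderBasis e) :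
    ∃ W : Submodule ℝ X, IsBlockSubspace e W ∧
      ∀ V : Submodule ℝ X, IsBlockSubspace e V → V ≤ W →
        KrivineSet e V = KrivineSet e W := by
  obtain ⟨U, hU⟩ := exists_exponent_cells
  obtain ⟨y, hy, hanti, hdec⟩ := exists_deciding_blockSeqs he U
  obtain ⟨w, hw, hwy⟩ := exists_diagonal_blockSeq hy
  have htail : ∀ j k, j ≤ k → w k ∈ closedSpan (y j) := fun j k hjk => hanti hjk (hwy k)
  refine ⟨closedSpan w, ⟨w, hw, rfl⟩, ?_⟩
  rintro _ ⟨v, hv, rfl⟩ hVW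
  refine (krivineSet_mono e hVW).antisymm fun p hp => ?_
  by_contra hpV
  obtain ⟨j, hpj, hj⟩ := exists_cell_disjoint_krivineSet hU e _ hp.1 hpV
  obtain ⟨N, hN, hwN⟩ := id hw
  obtain ⟨M, hM, hvM⟩ := id hv
  have hshift : closedSpan (fun k => v (k + N j)) ≤ closedSpan (y j) := by
    refine closedSpan_le (isClosed_closedSpan _) fun k => ?_
    refine he.mem_of_mem_closedSpan hN (fun i => (hwN i).2) (isClosed_closedSpan _) (htail j)
      (hVW (mem_closedSpan v _))
      (Submodule.span_mono (Set.image_mono fun i hi => ?_) (hvM (k + N j)).2)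
    have h1 : k + N j ≤ M (k + N j) := hM.le_apply
    have h2 : M (k + N j) ≤ i := hi.1
    exact Set.mem_Ici.2 (by omega)
  have hsub : closedSpan (fun k => v (k + N j)) ≤ closedSpan v :=
    closedSpan_le (isClosed_closedSpan _) fun k => mem_closedSpan v _
  have hd := hdec j _ (hv.shift (N j)) hshift (hj.mono_right (krivineSet_mono e hsub))
  exact Set.disjoint_left.1 hd hpj
    (he.krivineSet_subset hw (isClosed_closedSpan _) (htail (j + 1)) hp)
end

section
/- Let 1 ≤ p ≤ ∞, let 𝓔 = (E_j)_{j=1}^∞ and 𝓕 = (F_j)_{j=1}^∞ be sequences of nonzero closed subspaces of a Banach space, and suppose that 𝓔 is C-dominated by 𝓕. Assume that for every n there exist normalized vectors y_j ∈ E_j (1 ≤ j ≤ n) such that (y_j)_{j=1}^n is 2-equivalent to the unit vector basis of ℓ_p^n (of c_0^n when p = ∞). Then 𝓕 satisfies a lower ℓ_p-estimate with constant 2C. -/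
open scoped ENNReal
open Filter Topology

/-- `E` is `C`-dominated by `F`: `‖∑ x j‖ ≤ C ‖∑ y j‖` whenever `x j ∈ E j`, `y j ∈ F j`
and `‖x j‖ = ‖y j‖` for all `j`. -/
def DominatedBy {X : Type*} [NormedAddCommGroup X] [NormedSpace ℝ X]
    (E F : ℕ → Submodule ℝ X) (C : ℝ) : Prop :=
  ∀ (n : ℕ) (x y : Fin n → X), (∀ j, x j ∈ E j.val) → (∀ j, y j ∈ F j.val) →
    (∀ j, ‖x j‖ = ‖y j‖) → ‖∑ j, x j‖ ≤ C * ‖∑ j, y j‖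

/-- The sequence of subspaces `E` satisfies a lower `ℓ_p`-estimate with constant `C`. -/
def LowerLpEstimate {X : Type*} [NormedAddCommGroup X] [NormedSpace ℝ X] (p : ℝ≥0∞)
    (E : ℕ → Submodule ℝ X) (C : ℝ) : Prop :=
  ∀ (n : ℕ) (x : Fin n → X), (∀ j, x j ∈ E j.val) →
    lpNorm p (fun j => ‖x j‖) ≤ C * ‖∑ j, x j‖

/-- If `𝓔 = (E j)` is `C`-dominated by `𝓕 = (F j)` and for every `n` there are normalized
vectors `y j ∈ E j` forming a sequence `2`-equivalent to the unit vector basis of `ℓ_p^n`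
(of `c_0^n` when `p = ∞`), then `𝓕` satisfies a lower `ℓ_p`-estimate with constant `2C`. -/
theorem lower_estimate_of_dominated {X : Type*} [NormedAddCommGroup X] [NormedSpace ℝ X]
    [CompleteSpace X] (p : ℝ≥0∞) (hp : 1 ≤ p) (E F : ℕ → Submodule ℝ X) (C : ℝ)
    (hE : ∀ j, E j ≠ ⊥ ∧ IsClosed (E j : Set X))
    (hF : ∀ j, F j ≠ ⊥ ∧ IsClosed (F j : Set X))
    (hdom : DominatedBy E F C)
    (H : ∀ n : ℕ, ∃ y : Fin n → X, (∀ j, y j ∈ E j.val ∧ ‖y j‖ = 1) ∧ FinLpEquiv 2 p y) :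
    LowerLpEstimate p F (2 * C) := by
  intro n x hx
  obtain ⟨y, hy, hequiv⟩ := H n
  have hlower := (hequiv fun j => ‖x j‖).1
  have hle := hdom n (fun j => ‖x j‖ • y j) x (fun j => (E j).smul_mem _ (hy j).1) hx
    fun j => by rw [norm_smul, norm_norm, (hy j).2, mul_one]
  linarith
end

section
/- Let 1 ≤ p ≤ ∞, let (z_i)_{i=1}^∞ be a normalized basic sequence in a Banach space with basis constant at most M which is C-tail equivalent, and suppose that (z_i) is partitioned into consecutive finite blocks of lengths 2, 3, 4, … (i.e. (z_1,z_2), (z_3,z_4,z_5), (z_6,…,z_9), …) such that each block of length m is 2-equivalent to the unit vector basis of ℓ_p^m (of c_0^m when p = ∞). Then (z_i)_{i=1}^∞ is 16C(M+1)-equivalent to the unit vector basis of ℓ_p (of c_0 when p = ∞). -/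
open scoped ENNReal
open Filter Topology

/-- Two sequences are `C`-equivalent: for every finitely supported scalar sequence `a`,
`C⁻¹ ‖∑ a i • y i‖ ≤ ‖∑ a i • x i‖ ≤ C ‖∑ a i • y i‖`. -/
def SeqEquiv {X : Type*} [NormedAddCommGroup X] [NormedSpace ℝ X] (C : ℝ) (x y : ℕ → X) : Prop :=
  ∀ (n : ℕ) (a : Fin n → ℝ),
    C⁻¹ * ‖∑ i, a i • y i.val‖ ≤ ‖∑ i, a i • x i.val‖ ∧
      ‖∑ i, a i • x i.val‖ ≤ C * ‖∑ i, a i • y i.val‖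

/-- `x` is `C`-tail equivalent: for every `N` there is `k > N` such that `x` is
`C`-equivalent to its tail starting at `k`. -/
def TailEquiv {X : Type*} [NormedAddCommGroup X] [NormedSpace ℝ X] (C : ℝ) (x : ℕ → X) : Prop :=
  ∀ N : ℕ, ∃ k > N, SeqEquiv C x (fun n => x (n + k))

/-- The sequence `x` is `C`-equivalent to the unit vector basis of `ℓ_p`
(of `c_0` when `p = ∞`). -/
def EquivLpBasis {X : Type*} [NormedAddCommGroup X] [NormedSpace ℝ X] (C : ℝ) (p : ℝ≥0∞)
    (x : ℕ → X) : Prop :=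
  ∀ (n : ℕ) (a : Fin n → ℝ),
    C⁻¹ * lpNorm p a ≤ ‖∑ i, a i • x i.val‖ ∧ ‖∑ i, a i • x i.val‖ ≤ C * lpNorm p a

/-- The recursion for the index at which the `j`-th block starts. -/
lemma blockStart_succ (j : ℕ) : (j + 1) * (j + 1 + 3) / 2 = j * (j + 3) / 2 + (j + 2) := by
  rw [show (j + 1) * (j + 1 + 3) = j * (j + 3) + (j + 2) * 2 by ring,
    Nat.add_mul_div_right _ _ two_pos]

lemma blockStart_mono : Monotone fun j : ℕ => j * (j + 3) / 2 :=
  monotone_nat_of_le_succ fun j => by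
    rw [blockStart_succ]
    omega

lemma exists_block (k : ℕ) :
    ∃ j, j * (j + 3) / 2 ≤ k ∧ k < j * (j + 3) / 2 + (j + 2) := by
  induction k with
  | zero => exact ⟨0, by simp⟩
  | succ k ih =>
    obtain ⟨j, h₁, h₂⟩ := ih
    by_cases h : k + 1 < j * (j + 3) / 2 + (j + 2)
    · exact ⟨j, by omega, h⟩
    · exact ⟨j + 1, by rw [blockStart_succ]; omega, by rw [blockStart_succ]; omega⟩

/-- The finite sequence `a`, moved `k` places to the right and padded with zeros. -/
noncomputable def shiftPad {n : ℕ} (a : Fin n → ℝ) (k i : ℕ) : ℝ :=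
  if h : k ≤ i ∧ i - k < n then a ⟨i - k, h.2⟩ else 0

lemma shiftPad_add {n : ℕ} (a : Fin n → ℝ) (k : ℕ) (i : Fin n) :
    shiftPad a k (k + i) = a i := by
  simp [shiftPad]

lemma shiftPad_eq_zero {n : ℕ} (a : Fin n → ℝ) {k i : ℕ} (h : i < k ∨ k + n ≤ i) :
    shiftPad a k i = 0 :=
  dif_neg (by omega)

lemma sum_range_shiftPad {E : Type*} [AddCommMonoid E] {n : ℕ} (a : Fin n → ℝ) (k N : ℕ)
    (hN : k + n ≤ N) (G : ℝ → ℕ → E) (hG : ∀ i, G 0 i = 0) :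
    ∑ i ∈ Finset.range N, G (shiftPad a k i) i = ∑ i : Fin n, G (a i) (k + i) := by
  obtain ⟨d, rfl⟩ := Nat.exists_eq_add_of_le hN
  rw [Finset.sum_range_add, Finset.sum_range_add]
  have h₁ : ∑ i ∈ Finset.range k, G (shiftPad a k i) i = 0 :=
    Finset.sum_eq_zero fun i hi => by
      rw [shiftPad_eq_zero a (Or.inl (Finset.mem_range.1 hi)), hG]
  have h₂ : ∑ i ∈ Finset.range d, G (shiftPad a k (k + n + i)) (k + n + i) = 0 :=
    Finset.sum_eq_zero fun i _ => by
      rw [shiftPad_eq_zero a (Or.inr (Nat.le_add_right _ _)), hG]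
  rw [h₁, h₂, zero_add, add_zero, ← Fin.sum_univ_eq_sum_range
    (fun i => G (shiftPad a k (k + i)) (k + i))]
  simp only [shiftPad_add]

/-- Splitting a sum over a window into sums over two adjacent blocks covering it. -/
lemma sum_eq_sum_blocks {E : Type*} [AddCommMonoid E] {n : ℕ} (a : Fin n → ℝ)
    {k B l r : ℕ} (hB : B ≤ k) (hN : k + n ≤ B + l + r) (G : ℝ → ℕ → E)
    (hG : ∀ i, G 0 i = 0) :
    ∑ i : Fin n, G (a i) (k + i) =
      ∑ i : Fin l, G (shiftPad a k (B + i)) (B + i) +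
        ∑ i : Fin r, G (shiftPad a k (B + l + i)) (B + l + i) := by
  rw [← sum_range_shiftPad a k _ hN G hG, Finset.sum_range_add, Finset.sum_range_add,
    Finset.sum_eq_zero (s := Finset.range B), zero_add,
    ← Fin.sum_univ_eq_sum_range (fun i => G (shiftPad a k (B + i)) (B + i)),
    ← Fin.sum_univ_eq_sum_range (fun i => G (shiftPad a k (B + l + i)) (B + l + i))]
  intro i hi
  rw [shiftPad_eq_zero a (Or.inl ((Finset.mem_range.1 hi).trans_le hB)), hG]

lemma abs_le_lpNorm_top {n : ℕ} (a : Fin n → ℝ) (i : Fin n) : |a i| ≤ lpNorm ∞ a := by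
  rw [lpNorm_top]
  exact le_ciSup (f := fun i => |a i|) (Set.finite_range _).bddAbove i

lemma abs_shiftPad_le_lpNorm_top {n : ℕ} (a : Fin n → ℝ) (k i : ℕ) :
    |shiftPad a k i| ≤ lpNorm ∞ a := by
  unfold shiftPad
  split_ifs
  · exact abs_le_lpNorm_top _ _
  · simpa using lpNorm_nonneg ∞ a

/-- The `ℓ_p` norm of a finite sequence, compared with those of its parts in two adjacent
blocks that cover it. -/
lemma lpNorm_blocks {p : ℝ≥0∞} (hp : 1 ≤ p) {n : ℕ} (a : Fin n → ℝ) {k B l r : ℕ}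
    (hB : B ≤ k) (hN : k + n ≤ B + l + r) :
    lpNorm p (fun i : Fin l => shiftPad a k (B + i)) ≤ lpNorm p a ∧
      lpNorm p (fun i : Fin r => shiftPad a k (B + l + i)) ≤ lpNorm p a ∧
      lpNorm p a ≤ lpNorm p (fun i : Fin l => shiftPad a k (B + i)) +
        lpNorm p (fun i : Fin r => shiftPad a k (B + l + i)) := by
  by_cases hpt : p = ∞
  · subst hpt
    have h₁ := lpNorm_nonneg ∞ (fun i : Fin l => shiftPad a k (B + i))
    have h₂ := lpNorm_nonneg ∞ (fun i : Fin r => shiftPad a k (B + l + i))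
    refine ⟨?_, ?_, ?_⟩
    · rw [lpNorm_top]
      exact Real.iSup_le (fun i => abs_shiftPad_le_lpNorm_top _ _ _) (lpNorm_nonneg _ _)
    · rw [lpNorm_top]
      exact Real.iSup_le (fun i => abs_shiftPad_le_lpNorm_top _ _ _) (lpNorm_nonneg _ _)
    · rw [lpNorm_top a]
      refine Real.iSup_le (fun i => ?_) (add_nonneg h₁ h₂)
      rw [← shiftPad_add a k i]
      by_cases hi : k + i < B + l
      · have h := abs_le_lpNorm_top (fun i : Fin l => shiftPad a k (B + i))
          ⟨k + i - B, by omega⟩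
        simp only [show B + (k + i.val - B) = k + i by omega] at h
        linarith
      · have h := abs_le_lpNorm_top (fun i : Fin r => shiftPad a k (B + l + i))
          ⟨k + i - (B + l), by omega⟩
        simp only [show B + l + (k + i.val - (B + l)) = k + i by omega] at h
        linarith
  · have hq : 1 ≤ p.toReal := by
      simpa using ENNReal.toReal_mono hpt hp
    have hsum := sum_eq_sum_blocks a hB hN (fun x _ => |x| ^ p.toReal)
      fun _ => by simp [Real.zero_rpow (by linarith : p.toReal ≠ 0)]
    simp only [lpNorm, if_neg hpt, hsum]
    have h₁ : 0 ≤ ∑ i : Fin l, |shiftPad a k (B + i)| ^ p.toReal := by positivity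
    have h₂ : 0 ≤ ∑ i : Fin r, |shiftPad a k (B + l + i)| ^ p.toReal := by positivity
    exact ⟨Real.rpow_le_rpow h₁ (by linarith) (by positivity),
      Real.rpow_le_rpow h₂ (by linarith) (by positivity),
      Real.rpow_add_le_add_rpow h₁ h₂ (by positivity) ((div_le_one (by linarith)).2 hq)⟩

/-- The projection onto the initial segment ending at a block boundary, for vectors supported
in two adjacent blocks. -/
lemma norm_first_block_le {X : Type*} [NormedAddCommGroup X] [NormedSpace ℝ X] {z : ℕ → X}
    {M : ℝ} (hbasis : ∀ (n : ℕ) (a : Fin n → ℝ) (m : ℕ), m ≤ n →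
      ‖∑ i ∈ Finset.univ.filter (fun i : Fin n => i.val < m), a i • z i.val‖ ≤
        M * ‖∑ i, a i • z i.val‖)
    {n : ℕ} (a : Fin n → ℝ) {k B l r : ℕ} (hB : B ≤ k) (hN : k + n ≤ B + l + r) :
    ‖∑ i : Fin l, shiftPad a k (B + i) • z (B + i)‖ ≤ M * ‖∑ i : Fin n, a i • z (k + i)‖ := by
  have h := hbasis (B + l + r) (fun i => shiftPad a k i) (B + l) (by omega)
  rw [Finset.sum_filter, Fin.sum_univ_eq_sum_range
      (fun i => if i < B + l then shiftPad a k i • z i else 0),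
    Fin.sum_univ_eq_sum_range (fun i => shiftPad a k i • z i),
    sum_range_shiftPad a k _ hN (fun x i => x • z i) (fun _ => zero_smul _ _),
    Finset.sum_range_add, Finset.sum_range_add, Finset.sum_eq_zero (s := Finset.range B),
    Finset.sum_eq_zero (s := Finset.range r), zero_add, add_zero] at h
  · rw [Fin.sum_univ_eq_sum_range (fun i => shiftPad a k (B + i) • z (B + i))]
    convert h using 2
    refine Finset.sum_congr rfl fun i hi => (if_pos ?_).symm
    simpa using hi
  · intro i _
    exact if_neg (by omega)
  · intro i hi
    rw [shiftPad_eq_zero a (Or.inl ((Finset.mem_range.1 hi).trans_le hB)), zero_smul, ite_self]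

/-- Let `(z i)` be a normalized basic sequence with basis constant at most `M` which is
`C`-tail equivalent, partitioned into consecutive blocks of lengths `2, 3, 4, …` (the
`j`-th block starting at index `j(j+3)/2` and having length `j + 2`), each block of
length `m` being `2`-equivalent to the unit vector basis of `ℓ_p^m` (of `c_0^m` when
`p = ∞`).  Then `(z i)` is `16C(M+1)`-equivalent to the unit vector basis of `ℓ_p`
(of `c_0` when `p = ∞`). -/
theorem equivLpBasis_of_tail_equiv_blocks {X : Type*} [NormedAddCommGroup X]
    [NormedSpace ℝ X] [CompleteSpace X] (p : ℝ≥0∞) (hp : 1 ≤ p) (z : ℕ → X) (M C : ℝ)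
    (hnorm : ∀ i, ‖z i‖ = 1)
    (hbasis : ∀ (n : ℕ) (a : Fin n → ℝ) (m : ℕ), m ≤ n →
      ‖∑ i ∈ Finset.univ.filter (fun i : Fin n => i.val < m), a i • z i.val‖ ≤
        M * ‖∑ i, a i • z i.val‖)
    (htail : TailEquiv C z)
    (hblocks : ∀ j : ℕ,
      FinLpEquiv 2 p (fun i : Fin (j + 2) => z (j * (j + 3) / 2 + i.val))) :
    EquivLpBasis (16 * C * (M + 1)) p z := by
  intro n a
  obtain ⟨k, hk, hequiv⟩ := htail (n * (n + 3) / 2)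
  obtain ⟨j, hj₁, hj₂⟩ := exists_block k
  have hnj : n ≤ j := by
    by_contra! h
    have : (j + 1) * (j + 1 + 3) / 2 ≤ n * (n + 3) / 2 := blockStart_mono h
    rw [blockStart_succ] at this
    omega
  set B := j * (j + 3) / 2 with hBdef
  have hN : k + n ≤ B + (j + 2) + (j + 1 + 2) := by omega
  have hC : 1 ≤ C := by
    simpa [hnorm] using (hequiv 1 fun _ => 1).2
  have hM : 1 ≤ M := by
    simpa [hnorm] using hbasis 1 (fun _ => 1) 1 le_rfl
  have hC₀ : 0 < C := by linarith
  obtain ⟨hlow, hup⟩ := hequiv n a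
  simp only [add_comm _ k] at hlow hup
  obtain ⟨hl₁, hl₂, hl⟩ := lpNorm_blocks hp a hj₁ hN
  have hfirst := norm_first_block_le hbasis a hj₁ hN
  have hsplit := sum_eq_sum_blocks a hj₁ hN (fun x i => x • z i) fun _ => zero_smul _ _
  have hb₁ := hblocks j fun i => shiftPad a k (B + i)
  have hb₂ := hblocks (j + 1) fun i => shiftPad a k (B + (j + 2) + i)
  simp only [blockStart_succ, ← hBdef] at hb₁ hb₂
  set u := ∑ i : Fin (j + 2), shiftPad a k (B + i) • z (B + i)
  set v := ∑ i : Fin (j + 1 + 2), shiftPad a k (B + (j + 2) + i) • z (B + (j + 2) + i)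
  set w := ∑ i : Fin n, a i • z (k + i)
  set x := ∑ i : Fin n, a i • z i
  have hw : ‖w‖ ≤ ‖u‖ + ‖v‖ := hsplit ▸ norm_add_le u v
  have hv : ‖v‖ ≤ ‖w‖ + ‖u‖ := by
    rw [← add_sub_cancel_left u v, ← hsplit]
    exact norm_sub_le w u
  have hwx : ‖w‖ ≤ C * ‖x‖ := by
    rwa [inv_mul_le_iff₀ hC₀] at hlow
  have ha := lpNorm_nonneg p a
  constructor
  · rw [inv_mul_le_iff₀ (by positivity)]
    have hA : lpNorm p a ≤ 4 * (M + 1) * ‖w‖ := by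
      nlinarith [hb₁.1, hb₂.1, norm_nonneg w]
    calc lpNorm p a ≤ 4 * (M + 1) * (C * ‖x‖) := hA.trans (by gcongr)
      _ ≤ 16 * C * (M + 1) * ‖x‖ := by
        have : 0 ≤ C * (M + 1) * ‖x‖ := by positivity
        linarith
  · have hW : ‖w‖ ≤ 4 * lpNorm p a := by
      linarith [hb₁.2, hb₂.2]
    calc ‖x‖ ≤ C * (4 * lpNorm p a) := hup.trans (by gcongr)
      _ ≤ 16 * C * (M + 1) * lpNorm p a := by
        have h₁ : 0 ≤ C * lpNorm p a := by positivity
        have h₂ : 0 ≤ M * (C * lpNorm p a) := by positivity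
        linarith
end

section
/- Let X be a Banach space with a Schauder basis, let Σ be the set of all finite normalized block basic sequences of the basis, and let σ ⊆ Σ. Let V be an infinite-dimensional block subspace of X for which σ is strategically large, and let Y be the closed linear span of a block basic sequence (v_j)_{j=1}^∞ such that for some n the tail subspace [v_j : j ≥ n] is contained in V. Then σ is strategically large for Y. -/
open scoped ENNReal
open Filter Topology

/-- A finite normalized block basic sequence of `e`, encoded as a list. -/
def IsNormBlockList {X : Type*} [NormedAddCommGroup X] [NormedSpace ℝ X] (e : ℕ → X)
    (l : List X) : Prop :=
  ∃ N : ℕ → ℕ, StrictMono N ∧ ∀ (k : ℕ) (h : k < l.length),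
    ‖l.get ⟨k, h⟩‖ = 1 ∧ l.get ⟨k, h⟩ ∈ Submodule.span ℝ (e '' Set.Ico (N k) (N (k + 1)))

/-- `σ` is strategically large for `Y`: the vector player V has a winning strategy in the
Gowers game in which the subspace player S is restricted to block subspaces of `Y`.
A strategy for V assigns a vector to each finite sequence of subspaces played by S; it is
winning if, along every possible play `Z` of S, the vectors it produces are legal moves
(normalized and in the last subspace played) and some initial segment of them is in `σ`. -/
def StrategicallyLargeFor {X : Type*} [NormedAddCommGroup X] [NormedSpace ℝ X]
    (e : ℕ → X) (σ : Set (List X)) (Y : Submodule ℝ X) : Prop :=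
  ∃ str : (n : ℕ) → (Fin (n + 1) → Submodule ℝ X) → X,
    ∀ Z : ℕ → Submodule ℝ X,
      (∀ k, IsBlockSubspace e (Z k) ∧ Z k ≤ Y) →
      (∀ k, ‖str k (fun i : Fin (k + 1) => Z i.val)‖ = 1 ∧
        str k (fun i : Fin (k + 1) => Z i.val) ∈ Z k) ∧
      ∃ n : ℕ,
        (List.ofFn fun i : Fin (n + 1) => str i.val fun j : Fin (i.val + 1) => Z j.val) ∈ σ

/-- A Schauder basis is linearly independent. -/
theorem IsSchauderBasis.linearIndependent {X : Type*} [NormedAddCommGroup X] [NormedSpace ℝ X]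
    {e : ℕ → X} (he : IsSchauderBasis e) : LinearIndependent ℝ e := by
  rw [linearIndependent_iff]
  intro a ha
  have hzero : Tendsto (fun n => ∑ i ∈ Finset.range n, (0 : ℕ → ℝ) i • e i) atTop (𝓝 0) := by
    simp
  have hsum : Tendsto (fun n => ∑ i ∈ Finset.range n, a i • e i) atTop (𝓝 0) := by
    refine tendsto_const_nhds.congr' ?_
    filter_upwards [eventually_ge_atTop (a.support.sup id + 1)] with n hn
    rw [← ha, Finsupp.linearCombination_apply, Finsupp.sum]
    refine Finset.sum_subset (fun i hi => ?_) (fun i _ hi => ?_)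
    · exact Finset.mem_range.2 ((Nat.lt_succ_of_le (Finset.le_sup (f := id) hi)).trans_le hn)
    · simp [Finsupp.notMem_support_iff.1 hi]
  exact Finsupp.ext fun i => congrFun ((he 0).unique hsum hzero) i

/-- A block sequence of a linearly independent sequence is linearly independent. -/
theorem IsBlockSeq.linearIndependent {X : Type*} [NormedAddCommGroup X] [NormedSpace ℝ X]
    {e z : ℕ → X} (he : LinearIndependent ℝ e) (hz : IsBlockSeq e z) :
    LinearIndependent ℝ z := by
  obtain ⟨N, hN, hz⟩ := hz
  refine iSupIndep.linearIndependent
    (fun k => Submodule.span ℝ (e '' Set.Ico (N k) (N (k + 1)))) ?_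
    (fun k => (hz k).2) (fun k => (hz k).1)
  intro k
  simp_rw [← Submodule.span_iUnion, ← Set.image_iUnion]
  refine he.disjoint_span_image ?_
  simp only [Set.disjoint_iUnion_right]
  exact fun j hj => hN.monotone.pairwise_disjoint_on_Ico_succ hj.symm

/-- If the terms of a linearly independent sequence lie in a finite-dimensional enlargement of
`W`, then sufficiently long runs of consecutive terms span a subspace meeting `W` nontrivially. -/
theorem LinearIndependent.exists_ne_zero_mem_span_Ico {𝕜 E : Type*} [Field 𝕜] [AddCommGroup E]
    [Module 𝕜 E] {z : ℕ → E} (hz : LinearIndependent 𝕜 z) (W F : Submodule 𝕜 E)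
    [FiniteDimensional 𝕜 F] (hzWF : ∀ i, z i ∈ W ⊔ F) :
    ∃ d : ℕ, 0 < d ∧
      ∀ m, ∃ u ∈ W, u ≠ 0 ∧ u ∈ Submodule.span 𝕜 (z '' Set.Ico m (m + d)) := by
  have hF (i : ℕ) : W.mkQ (z i) ∈ F.map W.mkQ := by
    obtain ⟨w, hw, f, hf, hwf⟩ := Submodule.mem_sup.1 (hzWF i)
    refine ⟨f, hf, ?_⟩
    rw [← hwf, map_add, Submodule.mkQ_apply W w, (Submodule.Quotient.mk_eq_zero W).2 hw, zero_add]
  refine ⟨Module.finrank 𝕜 (F.map W.mkQ) + 1, Nat.succ_pos _, fun m => ?_⟩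
  set d := Module.finrank 𝕜 (F.map W.mkQ)
  have hdep : ¬ LinearIndependent 𝕜
      fun i : Fin (d + 1) => (⟨W.mkQ (z (m + i)), hF _⟩ : F.map W.mkQ) := by
    intro h
    simpa [d] using h.fintype_card_le_finrank
  obtain ⟨g, hg, i, hi⟩ := Fintype.not_linearIndependent_iff.1 hdep
  refine ⟨∑ j : Fin (d + 1), g j • z (m + j), ?_, fun h => hi ?_, ?_⟩
  · rw [← Submodule.Quotient.mk_eq_zero, ← Submodule.mkQ_apply]
    simpa using congrArg Subtype.val hg
  · exact Fintype.linearIndependent_iff.1 (hz.comp (fun j : Fin (d + 1) => m + (j : ℕ))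
      fun a b hab => Fin.ext (Nat.add_left_cancel hab)) g h i
  · refine Submodule.sum_mem _ fun j _ => Submodule.smul_mem _ _ (Submodule.subset_span ?_)
    exact ⟨m + j, ⟨by omega, by omega⟩, rfl⟩

/-- A block subspace contained in a finite-dimensional enlargement of a closed subspace `W`
contains a block subspace contained in `W`. -/
theorem IsBlockSubspace.exists_le_of_le_sup {X : Type*} [NormedAddCommGroup X] [NormedSpace ℝ X]
    {e : ℕ → X} (he : LinearIndependent ℝ e) {Z : Submodule ℝ X} (hZ : IsBlockSubspace e Z)
    {W : Submodule ℝ X} (hW : IsClosed (W : Set X)) (F : Submodule ℝ X) [FiniteDimensional ℝ F]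
    (hZWF : Z ≤ W ⊔ F) :
    ∃ Z' : Submodule ℝ X, IsBlockSubspace e Z' ∧ Z' ≤ Z ∧ Z' ≤ W := by
  obtain ⟨z, hz, rfl⟩ := hZ
  have hzZ (i : ℕ) : z i ∈ (Submodule.span ℝ (Set.range z)).topologicalClosure :=
    Submodule.le_topologicalClosure _ (Submodule.subset_span ⟨i, rfl⟩)
  obtain ⟨d, hd, hu⟩ :=
    (hz.linearIndependent he).exists_ne_zero_mem_span_Ico W F fun i => hZWF (hzZ i)
  choose u huW hu0 huz using fun k => hu (k * d)
  obtain ⟨N, hN, hz⟩ := hz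
  refine ⟨_, ⟨u, ⟨fun k => N (k * d), fun a b hab => hN ?_, fun k => ⟨hu0 k, ?_⟩⟩, rfl⟩, ?_, ?_⟩
  · exact Nat.mul_lt_mul_of_pos_right hab hd
  · refine Submodule.span_le.2 ?_ (huz k)
    rintro _ ⟨i, hi, rfl⟩
    refine Submodule.span_mono (Set.image_mono (Set.Ico_subset_Ico ?_ ?_)) (hz i).2
    · exact hN.monotone hi.1
    · refine hN.monotone ?_
      rw [Nat.add_mul, one_mul]
      exact hi.2
  · refine Submodule.topologicalClosure_mono (Submodule.span_le.2 ?_)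
    rintro _ ⟨k, rfl⟩
    exact Submodule.span_mono (Set.image_subset_range _ _) (huz k)
  · refine Submodule.topologicalClosure_minimal _ (Submodule.span_le.2 ?_) hW
    rintro _ ⟨k, rfl⟩
    exact huW k

/-- Up to a finite-dimensional subspace, the closed span of a sequence is that of its tail. -/
theorem topologicalClosure_span_range_le_sup {X : Type*} [NormedAddCommGroup X]
    [NormedSpace ℝ X] (v : ℕ → X) (n : ℕ) :
    (Submodule.span ℝ (Set.range v)).topologicalClosure ≤
      (Submodule.span ℝ (v '' Set.Ici n)).topologicalClosure ⊔
        Submodule.span ℝ (v '' Set.Iio n) := by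
  have : FiniteDimensional ℝ (Submodule.span ℝ (v '' Set.Iio n)) :=
    FiniteDimensional.span_of_finite ℝ ((Set.finite_Iio n).image v)
  refine Submodule.topologicalClosure_minimal _ (Submodule.span_le.2 ?_)
    (Submodule.isClosed_sup_finiteDimensional _ _ (Submodule.isClosed_topologicalClosure _))
  rintro _ ⟨j, rfl⟩
  rcases lt_or_ge j n with hj | hj
  · exact Submodule.mem_sup_right (Submodule.subset_span ⟨j, hj, rfl⟩)
  · exact Submodule.mem_sup_left
      (Submodule.le_topologicalClosure _ (Submodule.subset_span ⟨j, hj, rfl⟩))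

/-- Strategic largeness for `V` passes to `Y` when every block subspace of `Y` contains a block
subspace of `V`. -/
theorem StrategicallyLargeFor.of_forall_exists_le {X : Type*} [NormedAddCommGroup X]
    [NormedSpace ℝ X] {e : ℕ → X} {σ : Set (List X)} {V Y : Submodule ℝ X}
    (h : StrategicallyLargeFor e σ V)
    (hYV : ∀ Z, IsBlockSubspace e Z ∧ Z ≤ Y →
      ∃ Z' : Submodule ℝ X, IsBlockSubspace e Z' ∧ Z' ≤ Z ∧ Z' ≤ V) :
    StrategicallyLargeFor e σ Y := by
  choose! r hr hrZ hrV using hYV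
  obtain ⟨str, hstr⟩ := h
  refine ⟨fun k Z => str k fun i => r (Z i), fun Z hZ => ?_⟩
  obtain ⟨hlegal, hwin⟩ := hstr (fun k => r (Z k)) fun k => ⟨hr _ (hZ k), hrV _ (hZ k)⟩
  exact ⟨fun k => ⟨(hlegal k).1, hrZ _ (hZ k) (hlegal k).2⟩, hwin⟩

/-- If `σ` is strategically large for a block subspace `V` and `Y` is the closed linear
span of a block basic sequence `(v j)` whose tail `[v j : j ≥ n]` spans (after closure) a
subspace of `V`, then `σ` is strategically large for `Y`. -/
theorem strategicallyLarge_of_tail_subspace {X : Type*} [NormedAddCommGroup X]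
    [NormedSpace ℝ X] [CompleteSpace X] (e : ℕ → X) (he : IsSchauderBasis e)
    (σ : Set (List X)) (hσ : ∀ l ∈ σ, IsNormBlockList e l)
    (V : Submodule ℝ X) (hV : IsBlockSubspace e V)
    (hstrat : StrategicallyLargeFor e σ V)
    (v : ℕ → X) (hv : IsBlockSeq e v) (n : ℕ)
    (htail : (Submodule.span ℝ (v '' Set.Ici n)).topologicalClosure ≤ V) :
    StrategicallyLargeFor e σ ((Submodule.span ℝ (Set.range v)).topologicalClosure) := by
  have : FiniteDimensional ℝ (Submodule.span ℝ (v '' Set.Iio n)) :=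
    FiniteDimensional.span_of_finite ℝ ((Set.finite_Iio n).image v)
  refine hstrat.of_forall_exists_le fun Z ⟨hZ, hZY⟩ => ?_
  obtain ⟨Z', hZ', hZ'Z, hZ'W⟩ := hZ.exists_le_of_le_sup he.linearIndependent
    (Submodule.isClosed_topologicalClosure _) _
    (hZY.trans (topologicalClosure_span_range_le_sup v n))
  exact ⟨Z', hZ', hZ'Z, hZ'W.trans htail⟩
end
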